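/- Let R be a constructor TRS, ⊥ a fresh constant constructor, and R⊥ := {t → ⊥ : t ∈ T(F ∪ {⊥}, V) ∩ NF(R) and the root of t is defined}. Then for all n, the innermost runtime complexities satisfy rc^i_R(n) ≤ rc^i_{R ∪ R⊥}(n). -/

import Mathlib

set_option maxHeartbeats 1000000

/-- First-order terms over a signature `F`, with variables drawn from `ℕ`. -/
inductive Tm (F : Type) : Type
  | var : ℕ → Tm F
  | fn  : F → List (Tm F) → Tm F

instance {F : Type} : Inhabited (Tm F) := ⟨Tm.var 0⟩

/-- The size `|t|` of a term. -/
def Tm.size {F} : Tm F → ℕ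
  | .var _ => 1
  | .fn _ ts => 1 + (ts.attach.map fun t => t.1.size).sum
decreasing_by have := List.sizeOf_lt_of_mem t.2; simp_wf; omega

/-- The depth of a term (variables and constants have depth 0). -/
def Tm.depth {F} : Tm F → ℕ
  | .var _ => 0
  | .fn _ [] => 0
  | .fn f (t :: ts) => max (t.depth + 1) (Tm.fn f ts).depth

/-- A (quasi-)precedence: a preorder `le` (i.e. `f ≿ g`) on the signature whose
strict part `≻` is well-founded. -/
structure Precedence (F : Type) where
  le : F → F → Prop
  refl : ∀ f, le f f
  trans : ∀ {f g h}, le f g → le g h → le f h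
  wf : WellFounded (fun g f => le f g ∧ ¬ le g f)

/-- The strict part `f ≻ g` of a precedence. -/
def Precedence.strict {F} (P : Precedence F) (f g : F) : Prop := P.le f g ∧ ¬ P.le g f

/-- The equivalence part `f ∼ g` of a precedence. -/
def Precedence.equiv {F} (P : Precedence F) (f g : F) : Prop := P.le f g ∧ P.le g f

/-- Constructor terms: terms built from constructors and variables only. -/
inductive IsCtorTerm {F} (D : F → Bool) : Tm F → Prop
  | var (v) : IsCtorTerm D (.var v)
  | fn {f : F} {ts : List (Tm F)} :
      D f = false → (∀ t ∈ ts, IsCtorTerm D t) → IsCtorTerm D (.fn f ts)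

/-- Basic terms: a defined root symbol applied to constructor terms. -/
def Basic {F} (D : F → Bool) (t : Tm F) : Prop :=
  ∃ f ts, t = Tm.fn f ts ∧ D f = true ∧ ∀ s ∈ ts, IsCtorTerm D s

/-- Application of a substitution `σ : V → T(F,V)` to a term. -/
def subst {F} (σ : ℕ → Tm F) : Tm F → Tm F
  | .var v => σ v
  | .fn f ts => .fn f (ts.attach.map fun t => subst σ t.1)
decreasing_by have := List.sizeOf_lt_of_mem t.2; simp_wf; omega

/-- The variable `v` occurs in the term. -/
inductive VarIn {F} (v : ℕ) : Tm F → Prop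
  | var : VarIn v (.var v)
  | fn {f : F} {ts : List (Tm F)} {t : Tm F} : t ∈ ts → VarIn v t → VarIn v (.fn f ts)

/-- A term rewrite system: left-hand sides are not variables and all variables
of a right-hand side occur in the corresponding left-hand side. -/
def IsTRS {F} (R : Set (Tm F × Tm F)) : Prop :=
  ∀ lr ∈ R, (∀ v, lr.1 ≠ Tm.var v) ∧ (∀ v, VarIn v lr.2 → VarIn v lr.1)

/-- A constructor TRS: all left-hand sides are basic terms. -/
def ConstructorTRS {F} (D : F → Bool) (R : Set (Tm F × Tm F)) : Prop :=
  ∀ lr ∈ R, Basic D lr.1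

/-- The rewrite relation `→_R` induced by `R`. -/
inductive Rew {F} (R : Set (Tm F × Tm F)) : Tm F → Tm F → Prop
  | root {l r : Tm F} {σ : ℕ → Tm F} :
      (l, r) ∈ R → Rew R (subst σ l) (subst σ r)
  | congr {f : F} {pre post : List (Tm F)} {s t : Tm F} :
      Rew R s t → Rew R (.fn f (pre ++ s :: post)) (.fn f (pre ++ t :: post))

/-- `t` is an `R`-normal form. -/
def NFo {F} (R : Set (Tm F × Tm F)) (t : Tm F) : Prop := ∀ u, ¬ Rew R t u

/-- The innermost rewrite relation `i→_R`: contracted redexes have all their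
proper subterms in normal form. -/
inductive IRew {F} (R : Set (Tm F × Tm F)) : Tm F → Tm F → Prop
  | root {l r : Tm F} {σ : ℕ → Tm F} :
      (l, r) ∈ R →
      (∀ f us, subst σ l = Tm.fn f us → ∀ u ∈ us, NFo R u) →
      IRew R (subst σ l) (subst σ r)
  | congr {f : F} {pre post : List (Tm F)} {s t : Tm F} :
      IRew R s t → IRew R (.fn f (pre ++ s :: post)) (.fn f (pre ++ t :: post))

/-- `R` is completely defined: no defined symbol occurs in any normal form. -/
def CompletelyDefined {F} (D : F → Bool) (R : Set (Tm F × Tm F)) : Prop :=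
  ∀ t, NFo R t → IsCtorTerm D t

/-- `Steps r n s t`: a derivation of length `n` from `s` to `t`. -/
def Steps {α} (r : α → α → Prop) : ℕ → α → α → Prop
  | 0, s, t => s = t
  | n + 1, s, t => ∃ u, r s u ∧ Steps r n u t

/-- The innermost runtime complexity `rc^i_R(n)`: the supremum (in `ℕ∞`) of
the lengths of innermost derivations starting from basic terms of size at
most `n`. -/
noncomputable def rcI {F} (D : F → Bool) (R : Set (Tm F × Tm F)) (n : ℕ) : ℕ∞ :=
  sSup {m : ℕ∞ | ∃ (k : ℕ) (t u : Tm F),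
    m = (k : ℕ∞) ∧ Basic D t ∧ t.size ≤ n ∧ Steps (IRew R) k t u}

/-- The set `Tn`: constructor terms, and terms whose normal arguments are
constructor terms and whose safe arguments are again in `Tn`. -/
inductive TnSet {F} (D : F → Bool) (nrm : F → ℕ) : Tm F → Prop
  | ctor {t : Tm F} : IsCtorTerm D t → TnSet D nrm t
  | fn {f : F} {ts : List (Tm F)} :
      (∀ i, i < nrm f → i < ts.length → IsCtorTerm D (ts.getD i default)) →
      (∀ i, nrm f ≤ i → i < ts.length → TnSet D nrm (ts.getD i default)) →
      TnSet D nrm (.fn f ts)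

/-- Renaming of function symbols in a term. -/
def Tm.mapSym {F G} (h : F → G) : Tm F → Tm G
  | .var v => .var v
  | .fn f ts => .fn (h f) (ts.attach.map fun t => t.1.mapSym h)
decreasing_by have := List.sizeOf_lt_of_mem t.2; simp_wf; omega

/-- The defined symbols of the signature `F ∪ {⊥}` (`none` is the fresh
constructor `⊥`). -/
def liftOptD {F} (D : F → Bool) : Option F → Bool := fun o => o.elim false D

/-- The safe mapping on the signature `F ∪ {⊥}`. -/
def liftOptNrm {F} (nrm : F → ℕ) : Option F → ℕ := fun o => o.elim 0 nrm

/-- A TRS over `F` viewed as a TRS over `F ∪ {⊥}`. -/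
def embR {F} (R : Set (Tm F × Tm F)) : Set (Tm (Option F) × Tm (Option F)) :=
  {p | ∃ lr ∈ R, p = (Tm.mapSym some lr.1, Tm.mapSym some lr.2)}

/-- The TRS `R⊥`: rules `t → ⊥` for every `R`-normal form
`t ∈ T(F ∪ {⊥}, V)` whose root symbol is defined. -/
def botRules {F} (D : F → Bool) (R : Set (Tm F × Tm F)) :
    Set (Tm (Option F) × Tm (Option F)) :=
  {p | NFo (embR R) p.1 ∧ (∃ f ts, p.1 = Tm.fn (some f) ts ∧ D f = true) ∧
       p.2 = Tm.fn none []}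

open Relation

theorem Tm.inductionOn {F} {P : Tm F → Prop} (hvar : ∀ v, P (.var v))
    (hfn : ∀ f ts, (∀ t ∈ ts, P t) → P (.fn f ts)) : ∀ t, P t
  | .var v => hvar v
  | .fn f ts => hfn f ts fun t _ => Tm.inductionOn hvar hfn t
decreasing_by have := List.sizeOf_lt_of_mem ‹_›; simp_wf; omega

theorem Tm.size_fn {F} (f : F) (ts : List (Tm F)) :
    (Tm.fn f ts).size = 1 + (ts.map Tm.size).sum := by
  rw [Tm.size, List.attach_map_val (f := Tm.size)]

theorem subst_var {F} (σ : ℕ → Tm F) (v : ℕ) : subst σ (.var v) = σ v := by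
  rw [subst]

theorem subst_fn {F} (σ : ℕ → Tm F) (f : F) (ts : List (Tm F)) :
    subst σ (.fn f ts) = .fn f (ts.map (subst σ)) := by
  rw [subst, List.attach_map_val (f := subst σ)]

theorem Tm.mapSym_var {F G} (h : F → G) (v : ℕ) : (Tm.var v).mapSym h = .var v := by
  rw [Tm.mapSym]

theorem Tm.mapSym_fn {F G} (h : F → G) (f : F) (ts : List (Tm F)) :
    (Tm.fn f ts).mapSym h = .fn (h f) (ts.map (Tm.mapSym h)) := by
  rw [Tm.mapSym, List.attach_map_val (f := Tm.mapSym h)]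

theorem Tm.size_mapSym {F G} (h : F → G) (t : Tm F) : (t.mapSym h).size = t.size := by
  induction t using Tm.inductionOn with
  | hvar v => simp [Tm.mapSym_var, Tm.size]
  | hfn f ts ih =>
    rw [Tm.mapSym_fn, Tm.size_fn, Tm.size_fn, List.map_map]
    congr 2
    exact List.map_congr_left ih

theorem IsCtorTerm.mapSym_some {F} {D : F → Bool} {t : Tm F} (h : IsCtorTerm D t) :
    IsCtorTerm (liftOptD D) (t.mapSym some) := by
  induction h with
  | var v => rw [Tm.mapSym_var]; exact .var v
  | fn hf _ ih =>
    rw [Tm.mapSym_fn]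
    refine .fn hf fun t ht => ?_
    obtain ⟨s, hs, rfl⟩ := List.mem_map.1 ht
    exact ih s hs

theorem Basic.mapSym_some {F} {D : F → Bool} {t : Tm F} (h : Basic D t) :
    Basic (liftOptD D) (t.mapSym some) := by
  obtain ⟨f, ts, rfl, hf, hts⟩ := h
  refine ⟨some f, _, Tm.mapSym_fn _ _ _, hf, fun s hs => ?_⟩
  obtain ⟨t, ht, rfl⟩ := List.mem_map.1 hs
  exact (hts t ht).mapSym_some

theorem NFo.arg {F} {R : Set (Tm F × Tm F)} {f : F} {ts : List (Tm F)}
    (h : NFo R (.fn f ts)) {t : Tm F} (ht : t ∈ ts) : NFo R t := by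
  obtain ⟨pre, post, rfl⟩ := List.append_of_mem ht
  exact fun u hu => h _ (.congr hu)

theorem NFo.of_varIn {F} {R : Set (Tm F × Tm F)} {σ : ℕ → Tm F} {v : ℕ} {t : Tm F}
    (hv : VarIn v t) (h : NFo R (subst σ t)) : NFo R (σ v) := by
  induction hv with
  | var => rwa [subst_var] at h
  | fn ht _ ih =>
    rw [subst_fn] at h
    exact ih (h.arg (List.mem_map_of_mem ht))

theorem IRew.rew {F} {R : Set (Tm F × Tm F)} {s t : Tm F} (h : IRew R s t) : Rew R s t := by
  induction h with
  | root h _ => exact .root h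
  | congr _ ih => exact .congr ih

theorem IRew.args {F} {R : Set (Tm F × Tm F)} {f : F} {ss ts : List (Tm F)}
    (h : List.Forall₂ (ReflTransGen (IRew R)) ss ts) (pre : List (Tm F)) :
    ReflTransGen (IRew R) (.fn f (pre ++ ss)) (.fn f (pre ++ ts)) := by
  induction h generalizing pre with
  | nil => exact .refl
  | @cons s t ss ts hst _ ih =>
    refine (hst.lift (fun x => Tm.fn f (pre ++ x :: ss)) fun _ _ h => .congr h).trans ?_
    simpa using ih (pre ++ [t])

theorem Steps.add {α} {r : α → α → Prop} {m n : ℕ} {a b c : α} (h : Steps r m a b)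
    (h' : Steps r n b c) : Steps r (m + n) a c := by
  induction m generalizing a with
  | zero => obtain rfl : a = b := h; simpa using h'
  | succ m ih =>
    obtain ⟨u, hu, h⟩ := h
    rw [Nat.add_right_comm]
    exact ⟨u, hu, ih h⟩

theorem Relation.TransGen.exists_steps {α} {r : α → α → Prop} {a b : α} (h : TransGen r a b) :
    ∃ m, 1 ≤ m ∧ Steps r m a b := by
  induction h with
  | single h => exact ⟨1, le_rfl, _, h, rfl⟩
  | tail _ h ih =>
    obtain ⟨m, hm, ih⟩ := ih
    exact ⟨m + 1, by omega, ih.add ⟨_, h, rfl⟩⟩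

theorem nfo_var {F} {R : Set (Tm F × Tm F)} (hR : ∀ lr ∈ R, ∀ v, lr.1 ≠ Tm.var v)
    (v : ℕ) : NFo R (.var v) := by
  intro u h
  generalize hs : Tm.var v = s at h
  cases h with
  | @root l r σ hlr =>
    cases l with
    | var w => exact hR _ hlr w rfl
    | fn f ts => simp [subst_fn] at hs
  | congr => cases hs

/-- Linear patterns `f(x₀,…,xₙ₋₁)` are normal forms as soon as some instance is. -/
theorem NFo.linear_pattern {F} {R : Set (Tm F × Tm F)}
    (hR : ∀ lr ∈ R, ∀ v, lr.1 ≠ Tm.var v) {f : F} {ts : List (Tm F)}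
    (h : NFo R (.fn f ts)) :
    NFo (embR R) (.fn (some f) ((List.range ts.length).map Tm.var)) := by
  have hemb : ∀ lr ∈ embR R, ∀ v, lr.1 ≠ Tm.var v := by
    rintro _ ⟨⟨l, r⟩, hlr, rfl⟩ v hv
    cases l with
    | var w => exact hR _ hlr w rfl
    | fn g ls => simp [Tm.mapSym_fn] at hv
  intro u hu
  generalize hs : Tm.fn (some f) ((List.range ts.length).map Tm.var) = s at hu
  cases hu with
  | @root _ _ σ hlr =>
    obtain ⟨⟨l, r⟩, hlr, heq⟩ := hlr
    cases heq
    cases l with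
    | var w => exact hR _ hlr w rfl
    | fn g ls =>
      simp only [Tm.mapSym_fn, subst_fn, Tm.fn.injEq, Option.some.injEq, List.map_map] at hs
      obtain ⟨rfl, hs⟩ := hs
      let τ : ℕ → Tm F := fun v =>
        match σ v with
        | .var i => ts.getD i default
        | .fn _ _ => default
      refine h (subst τ r) ?_
      have hl : subst τ (.fn f ls) = .fn f ts := by
        have hlen : ts.length = ls.length := by simpa using congrArg List.length hs
        rw [subst_fn]
        congr 1
        refine List.ext_getElem (by simp [hlen]) fun i hi hi' => ?_
        have hi₁ : i < ls.length := by simpa using hi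
        have key : Tm.var i = subst σ ((ls[i]).mapSym some) := by
          have := congrArg (fun x => x[i]?) hs
          simpa [hi', hi₁] using this
        rw [List.getElem_map]
        cases hli : ls[i] with
        | var w =>
          rw [hli, Tm.mapSym_var, subst_var] at key
          simp [subst_var, τ, ← key, hi']
        | fn g us => simp [hli, Tm.mapSym_fn, subst_fn] at key
      rw [← hl]
      exact .root hlr
  | @congr g pre post s t hst =>
    have hmem : s ∈ (List.range ts.length).map Tm.var := by
      have := (Tm.fn.inj hs).2
      simp [this]
    obtain ⟨i, _, rfl⟩ := List.mem_map.1 hmem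
    exact nfo_var hemb i _ hst

theorem IsCtorTerm.nfo_extension {F} {D : F → Bool} {R : Set (Tm F × Tm F)}
    (hctor : ConstructorTRS D R) {t : Tm (Option F)} (ht : IsCtorTerm (liftOptD D) t) :
    NFo (embR R ∪ botRules D R) t := by
  intro u hu
  induction hu with
  | @root l r σ hlr =>
    obtain ⟨f, ts, rfl, hf⟩ : ∃ f ts, l = Tm.fn (some f) ts ∧ D f = true := by
      rcases hlr with ⟨lr, hlr, heq⟩ | ⟨_, h, _⟩
      · cases heq
        obtain ⟨f, ts, hl, hf, _⟩ := hctor _ hlr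
        exact ⟨f, _, by rw [hl, Tm.mapSym_fn], hf⟩
      · exact h
    rw [subst_fn] at ht
    cases ht with
    | fn hf' _ => simp [liftOptD, hf] at hf'
  | congr _ ih =>
    cases ht with
    | fn _ hts => exact ih (hts _ (by simp))

/-- Replace every outermost subterm with a defined root by `⊥`. -/
def collapse {F} (D : F → Bool) : Tm F → Tm (Option F)
  | .var v => .var v
  | .fn f ts =>
    bif D f then .fn none [] else .fn (some f) (ts.attach.map fun t => collapse D t.1)
decreasing_by have := List.sizeOf_lt_of_mem t.2; simp_wf; omega

theorem collapse_var {F} (D : F → Bool) (v : ℕ) : collapse D (.var v) = .var v := by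
  rw [collapse]

theorem collapse_of_defined {F} {D : F → Bool} {f : F} (hf : D f = true) (ts : List (Tm F)) :
    collapse D (.fn f ts) = .fn none [] := by
  rw [collapse, hf, cond_true]

theorem collapse_of_ctor {F} {D : F → Bool} {f : F} (hf : D f = false) (ts : List (Tm F)) :
    collapse D (.fn f ts) = .fn (some f) (ts.map (collapse D)) := by
  rw [collapse, hf, cond_false, List.attach_map_val (f := collapse D)]

theorem isCtorTerm_collapse {F} (D : F → Bool) (t : Tm F) :
    IsCtorTerm (liftOptD D) (collapse D t) := by
  induction t using Tm.inductionOn with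
  | hvar v => rw [collapse_var]; exact .var v
  | hfn f ts ih =>
    cases hf : D f with
    | true => rw [collapse_of_defined hf]; exact .fn rfl (by simp)
    | false =>
      rw [collapse_of_ctor hf]
      refine .fn hf fun t ht => ?_
      obtain ⟨s, hs, rfl⟩ := List.mem_map.1 ht
      exact ih s hs

theorem IsCtorTerm.collapse_subst {F} {D : F → Bool} {t : Tm F} (ht : IsCtorTerm D t)
    (σ : ℕ → Tm F) :
    collapse D (subst σ t) = subst (fun v => collapse D (σ v)) (t.mapSym some) := by
  induction ht with
  | var v => rw [Tm.mapSym_var, subst_var, subst_var]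
  | fn hf _ ih =>
    rw [Tm.mapSym_fn, subst_fn, subst_fn, collapse_of_ctor hf, List.map_map, List.map_map]
    congr 1
    exact List.map_congr_left ih

/-- `Collapses D R t u`: `u` arises from `t` by replacing some `R`-normal subterms with a
defined root by `⊥`. -/
inductive Collapses {F} (D : F → Bool) (R : Set (Tm F × Tm F)) : Tm F → Tm (Option F) → Prop
  | var (v : ℕ) : Collapses D R (.var v) (.var v)
  | fn {f : F} {ts : List (Tm F)} {us : List (Tm (Option F))} :
      List.Forall₂ (Collapses D R) ts us → Collapses D R (.fn f ts) (.fn (some f) us)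
  | bot {f : F} {ts : List (Tm F)} :
      D f = true → NFo R (.fn f ts) → Collapses D R (.fn f ts) (.fn none [])

theorem List.forall₂_map_of_mem {α β γ} {r : β → γ → Prop} {f : α → β} {g : α → γ} {l : List α}
    (h : ∀ a ∈ l, r (f a) (g a)) : List.Forall₂ r (l.map f) (l.map g) := by
  rw [List.forall₂_map_left_iff, List.forall₂_map_right_iff, List.forall₂_same]
  exact h

theorem collapses_mapSym {F} (D : F → Bool) (R : Set (Tm F × Tm F)) (t : Tm F) :
    Collapses D R t (t.mapSym some) := by
  induction t using Tm.inductionOn with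
  | hvar v => rw [Tm.mapSym_var]; exact .var v
  | hfn f ts ih =>
    rw [Tm.mapSym_fn]
    exact .fn (by simpa using List.forall₂_map_of_mem (f := id) ih)

theorem collapses_collapse {F} {D : F → Bool} {R : Set (Tm F × Tm F)} {t : Tm F}
    (h : NFo R t) : Collapses D R t (collapse D t) := by
  induction t using Tm.inductionOn with
  | hvar v => rw [collapse_var]; exact .var v
  | hfn f ts ih =>
    cases hf : D f with
    | true => rw [collapse_of_defined hf]; exact .bot hf h
    | false =>
      rw [collapse_of_ctor hf]
      exact .fn (by
        simpa using List.forall₂_map_of_mem (f := id) fun t ht => ih t ht (h.arg ht))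

theorem collapses_subst {F} {D : F → Bool} {R : Set (Tm F × Tm F)} {σ : ℕ → Tm F} {t : Tm F}
    (h : ∀ v, VarIn v t → NFo R (σ v)) :
    Collapses D R (subst σ t) (subst (fun v => collapse D (σ v)) (t.mapSym some)) := by
  induction t using Tm.inductionOn with
  | hvar v =>
    rw [Tm.mapSym_var, subst_var, subst_var]
    exact collapses_collapse (h v .var)
  | hfn f ts ih =>
    rw [Tm.mapSym_fn, subst_fn, subst_fn, List.map_map]
    exact .fn (List.forall₂_map_of_mem fun t ht => ih t ht fun v hv => h v (.fn ht hv))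

theorem irew_bot {F} {D : F → Bool} {R : Set (Tm F × Tm F)} (hctor : ConstructorTRS D R)
    (hR : ∀ lr ∈ R, ∀ v, lr.1 ≠ Tm.var v) {f : F} {ts : List (Tm F)} (hf : D f = true)
    (h : NFo R (.fn f ts)) :
    IRew (embR R ∪ botRules D R) (.fn (some f) (ts.map (collapse D))) (.fn none []) := by
  have hl : subst (fun i => collapse D (ts.getD i default))
      (.fn (some f) ((List.range ts.length).map Tm.var)) =
      .fn (some f) (ts.map (collapse D)) := by
    rw [subst_fn]
    congr 1
    refine List.ext_getElem (by simp) fun i hi hi' => ?_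
    have : i < ts.length := by simpa using hi
    simp [subst_var, this]
  have hr : subst (fun i => collapse D (ts.getD i default)) (.fn none []) = .fn none [] := by
    rw [subst_fn, List.map_nil]
  rw [← hl, ← hr]
  refine .root (Or.inr ⟨h.linear_pattern hR, ⟨f, _, rfl, hf⟩, rfl⟩) ?_
  rw [hl]
  rintro _ _ ⟨⟩ u hu
  obtain ⟨t, _, rfl⟩ := List.mem_map.1 hu
  exact (isCtorTerm_collapse D t).nfo_extension hctor

theorem Collapses.normalize {F} {D : F → Bool} {R : Set (Tm F × Tm F)}
    (hctor : ConstructorTRS D R) (hR : ∀ lr ∈ R, ∀ v, lr.1 ≠ Tm.var v) {t : Tm F}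
    {u : Tm (Option F)} (h : NFo R t) (htu : Collapses D R t u) :
    ReflTransGen (IRew (embR R ∪ botRules D R)) u (collapse D t) := by
  induction t using Tm.inductionOn generalizing u with
  | hvar v => cases htu; rw [collapse_var]
  | hfn f ts ih =>
    cases htu with
    | bot hf _ => rw [collapse_of_defined hf]
    | @fn _ _ us hus =>
      have hargs : ReflTransGen (IRew (embR R ∪ botRules D R)) (.fn (some f) us)
          (.fn (some f) (ts.map (collapse D))) := by
        refine IRew.args (pre := []) ?_
        rw [List.forall₂_map_right_iff, List.forall₂_iff_get]
        rw [List.forall₂_iff_get] at hus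
        exact ⟨hus.1.symm, fun i hi hi' =>
          ih _ (List.get_mem _ _) (h.arg (List.get_mem _ _)) (hus.2 i hi' hi)⟩
      cases hf : D f with
      | false => rwa [collapse_of_ctor hf]
      | true =>
        rw [collapse_of_defined hf]
        exact hargs.tail (irew_bot hctor hR hf h)

theorem Collapses.simulate {F} {D : F → Bool} {R : Set (Tm F × Tm F)} (hTRS : IsTRS R)
    (hctor : ConstructorTRS D R) {s s' : Tm F} {t : Tm (Option F)} (hs : IRew R s s')
    (hst : Collapses D R s t) :
    ∃ t', TransGen (IRew (embR R ∪ botRules D R)) t t' ∧ Collapses D R s' t' := by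
  have hR : ∀ lr ∈ R, ∀ v, lr.1 ≠ Tm.var v := fun lr hlr => (hTRS lr hlr).1
  induction hs generalizing t with
  | @root l r σ hlr hnf =>
    obtain ⟨f, ls, hl, hf, hls⟩ := hctor _ hlr
    obtain rfl : l = .fn f ls := hl
    have hred := Rew.root (σ := σ) hlr
    rw [subst_fn] at hst hnf hred
    have hnf' : ∀ l ∈ ls, NFo R (subst σ l) :=
      fun l hl => hnf _ _ rfl _ (List.mem_map_of_mem hl)
    cases hst with
    | bot _ h => exact absurd hred (h _)
    | @fn _ _ us hus =>
      let τ : ℕ → Tm (Option F) := fun v => collapse D (σ v)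
      have hargs : ReflTransGen (IRew (embR R ∪ botRules D R)) (.fn (some f) us)
          (subst τ ((Tm.fn f ls).mapSym some)) := by
        rw [Tm.mapSym_fn, subst_fn, List.map_map]
        refine IRew.args (pre := []) ?_
        rw [List.forall₂_map_right_iff, List.forall₂_iff_get]
        rw [List.forall₂_map_left_iff, List.forall₂_iff_get] at hus
        refine ⟨hus.1.symm, fun i hi hi' => ?_⟩
        have hmem := List.get_mem ls ⟨i, hi'⟩
        have := (hus.2 i hi' hi).normalize hctor hR (hnf' _ hmem)
        rwa [(hls _ hmem).collapse_subst] at this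
      refine ⟨subst τ (r.mapSym some), .tail' hargs (.root (Or.inl ⟨_, hlr, rfl⟩) ?_),
        collapses_subst fun v hv => ?_⟩
      · rw [Tm.mapSym_fn, subst_fn, List.map_map]
        rintro _ _ ⟨⟩ u hu
        obtain ⟨l, hl, rfl⟩ := List.mem_map.1 hu
        rw [Function.comp_apply, ← (hls l hl).collapse_subst]
        exact (isCtorTerm_collapse D _).nfo_extension hctor
      · cases (hTRS _ hlr).2 v hv with
        | fn hl hv => exact (hnf' _ hl).of_varIn hv
  | @congr f pre post s s' hs ih =>
    cases hst with
    | bot _ h => exact absurd (Rew.congr hs.rew) (h _)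
    | @fn _ _ us hus =>
      obtain ⟨pre', rest, hpre, hrest, rfl⟩ : ∃ pre' rest, List.Forall₂ (Collapses D R) pre pre' ∧
          List.Forall₂ (Collapses D R) (s :: post) rest ∧ us = pre' ++ rest :=
        ⟨_, _, (List.forall₂_take_append _ _ _ hus.flip).flip,
          (List.forall₂_drop_append _ _ _ hus.flip).flip, (List.take_append_drop _ _).symm⟩
      cases hrest with
      | @cons _ t _ post' hst hpost =>
        obtain ⟨t', htt', ht'⟩ := ih hst
        exact ⟨.fn (some f) (pre' ++ t' :: post'),
          htt'.lift (fun x => Tm.fn (some f) (pre' ++ x :: post')) fun _ _ h => .congr h,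
          .fn (List.rel_append hpre (.cons ht' hpost))⟩

theorem Collapses.simulate_steps {F} {D : F → Bool} {R : Set (Tm F × Tm F)} (hTRS : IsTRS R)
    (hctor : ConstructorTRS D R) {k : ℕ} {s s' : Tm F} {t : Tm (Option F)}
    (hs : Steps (IRew R) k s s') (hst : Collapses D R s t) :
    ∃ m t', k ≤ m ∧ Steps (IRew (embR R ∪ botRules D R)) m t t' := by
  induction k generalizing s t with
  | zero => exact ⟨0, t, le_rfl, rfl⟩
  | succ k ih =>
    obtain ⟨u, hu, hs⟩ := hs
    obtain ⟨v, htv, huv⟩ := hst.simulate hTRS hctor hu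
    obtain ⟨n, hn, htv⟩ := htv.exists_steps
    obtain ⟨m, t', hm, hvt⟩ := ih hs huv
    exact ⟨n + m, t', by omega, htv.add hvt⟩

/-- The innermost runtime complexity of a constructor TRS `R` is bounded by
that of `R ∪ R⊥`. -/
theorem rc_le_rc_extension {F : Type} (D : F → Bool)
    (R : Set (Tm F × Tm F)) (hTRS : IsTRS R) (hctor : ConstructorTRS D R) :
    ∀ n : ℕ, rcI D R n ≤ rcI (liftOptD D) (embR R ∪ botRules D R) n := by
  intro n
  refine sSup_le ?_
  rintro _ ⟨k, t, u, rfl, ht, hn, hs⟩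
  obtain ⟨m, u', hkm, hs'⟩ := (collapses_mapSym D R t).simulate_steps hTRS hctor hs
  exact (Nat.cast_le.2 hkm).trans <| le_sSup
    ⟨m, t.mapSym some, u', rfl, ht.mapSym_some, (t.size_mapSym some).trans_le hn, hs'⟩
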